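/- arXiv:2401.10223 — 2 statements merged into one kernel-verified Lean document; each statement's English description precedes it below -/
import Mathlib

section
/- Let (Ω, 𝒜, ℙ) be a probability space, S a measurable space, P a nonzero finite measure on S, N ≥ 1 an integer, d ∈ ℕ, and M, K, L ≥ 0. Let H : Ω × S → ℝ be jointly measurable with 0 < ∫_S e^{H(ω,σ)} dP(σ) < ∞ for every ω, let m : S → ℝ^d be measurable with |m(σ)| ≤ M for all σ, and let G : ℝ^d → ℝ be measurable, bounded by K on the closed ball of radius M, and Lipschitz with constant L on the closed ball of radius M. For ω ∈ Ω define F̃(ω,t,x) = (1/N) log ∫_S exp( H(ω,σ) + tN G(m(σ)) + N x·m(σ) ) dP(σ), and assume 𝔼|F̃(·,0,0)| < ∞. Let F(t,x) = 𝔼 F̃(·,t,x). Then F is finite everywhere, jointly convex, Lipschitz with |F(t,x) − F(t',x')| ≤ K|t−t'| + M|x−x'|, and differentiable at every (t,x) with ∂_t F(t,x) = 𝔼⟨G∘m⟩_{ω,t,x}, ∇_x F(t,x) = 𝔼⟨m⟩_{ω,t,x}, and Δ_x F(t,x) = N 𝔼⟨|m − ⟨m⟩_{ω,t,x}|²⟩_{ω,t,x}.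 Moreover, at every (t,x): |∂_t F(t,x) − G(∇_x F(t,x))| ≤ L 𝔼⟨|m − ⟨m⟩_{ω,t,x}|⟩_{ω,t,x} + L 𝔼|⟨m⟩_{ω,t,x} − 𝔼⟨m⟩_{ω,t,x}| ≤ L ( N^{-1} Δ_x F(t,x) )^{1/2} + L 𝔼|∇_x F̃(ω,t,x) − ∇_x F(t,x)|. -/
open MeasureTheory
open scoped InnerProductSpace

/-- The Gibbs average `⟨f⟩_Φ = (∫ f e^Φ dP)/(∫ e^Φ dP)` associated with a weight `Φ`. -/
noncomputable def gibbsAvg {S : Type*} [MeasurableSpace S] (P : Measure S) (Φ : S → ℝ)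
    {E : Type*} [NormedAddCommGroup E] [NormedSpace ℝ E] (f : S → E) : E :=
  (∫ σ, Real.exp (Φ σ) ∂P)⁻¹ • ∫ σ, Real.exp (Φ σ) • f σ ∂P


section Gibbs

open Real

variable {S : Type*} [MeasurableSpace S] {P : Measure S} {Φ : S → ℝ}

lemma gibbsAvg_eq_integral_tilted {E : Type*} [NormedAddCommGroup E] [NormedSpace ℝ E]
    (P : Measure S) (Φ : S → ℝ) (f : S → E) : gibbsAvg P Φ f = ∫ σ, f σ ∂(P.tilted Φ) := by
  rw [integral_tilted, gibbsAvg, ← integral_smul]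
  simp only [smul_smul, div_eq_inv_mul]

lemma norm_gibbsAvg_le {E : Type*} [NormedAddCommGroup E] [NormedSpace ℝ E] {C : ℝ} {f : S → E}
    [NeZero P] (hΦ : Integrable (fun σ => exp (Φ σ)) P) (hf : ∀ σ, ‖f σ‖ ≤ C) :
    ‖gibbsAvg P Φ f‖ ≤ C := by
  have := isProbabilityMeasure_tilted hΦ
  rw [gibbsAvg_eq_integral_tilted]
  simpa using norm_integral_le_of_norm_le_const (μ := P.tilted Φ) (ae_of_all _ hf)

lemma integrable_exp_add_of_abs_le {g : S → ℝ} {c : ℝ} (hΦ : Integrable (fun σ => exp (Φ σ)) P)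
    (hg : AEMeasurable g P) (hgc : ∀ σ, |g σ| ≤ c) :
    Integrable (fun σ => exp (Φ σ + g σ)) P := by
  simp only [exp_add]
  refine hΦ.mul_bdd (c := exp c) hg.exp.aestronglyMeasurable (ae_of_all _ fun σ => ?_)
  rw [norm_of_nonneg (exp_pos _).le]
  exact exp_le_exp.2 ((le_abs_self _).trans (hgc σ))

/-- The convexity (tangent line) inequality for the log-partition function. -/
lemma gibbsAvg_le_log_integral_exp_add_sub [NeZero P] {g : S → ℝ} {c : ℝ}
    (hΦ : Integrable (fun σ => exp (Φ σ)) P) (hg : AEMeasurable g P) (hgc : ∀ σ, |g σ| ≤ c) :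
    gibbsAvg P Φ g ≤ log (∫ σ, exp (Φ σ + g σ) ∂P) - log (∫ σ, exp (Φ σ) ∂P) := by
  have hint := integrable_exp_add_of_abs_le hΦ hg hgc
  have := isProbabilityMeasure_tilted hΦ
  have hg' : AEMeasurable g (P.tilted Φ) := hg.mono_ac (tilted_absolutelyContinuous _ _)
  have hgi : Integrable g (P.tilted Φ) :=
    Integrable.of_bound hg'.aestronglyMeasurable c (ae_of_all _ hgc)
  have hei : Integrable (fun σ => exp (g σ)) (P.tilted Φ) := by
    rw [integrable_tilted_iff hΦ]
    simpa only [exp_add, smul_eq_mul] using hint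
  rw [← log_div (integral_exp_pos hint).ne' (integral_exp_pos hΦ).ne']
  have h1 : (∫ σ, exp (Φ σ + g σ) ∂P) / (∫ σ, exp (Φ σ) ∂P) = ∫ σ, exp (g σ) ∂(P.tilted Φ) :=
    (integral_exp_tilted Φ g).symm
  rw [h1, gibbsAvg_eq_integral_tilted, le_log_iff_exp_le (integral_exp_pos hei)]
  exact convexOn_exp.map_integral_le continuous_exp.continuousOn isClosed_univ
    (ae_of_all _ fun _ => Set.mem_univ _) hgi hei

lemma abs_log_integral_exp_add_sub_le [NeZero P] {g : S → ℝ} {c : ℝ}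
    (hΦ : Integrable (fun σ => exp (Φ σ)) P) (hg : AEMeasurable g P) (hgc : ∀ σ, |g σ| ≤ c) :
    |log (∫ σ, exp (Φ σ + g σ) ∂P) - log (∫ σ, exp (Φ σ) ∂P)| ≤ c := by
  have hint := integrable_exp_add_of_abs_le hΦ hg hgc
  have h1 := gibbsAvg_le_log_integral_exp_add_sub hΦ hg hgc
  have hgc' : ∀ σ, |(-g) σ| ≤ c := fun σ => by simpa using hgc σ
  have h2 := gibbsAvg_le_log_integral_exp_add_sub hint hg.neg hgc'
  simp only [Pi.neg_apply, add_neg_cancel_right] at h2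
  have h3 : |gibbsAvg P Φ g| ≤ c := norm_gibbsAvg_le (f := g) hΦ hgc
  have h4 : |gibbsAvg P (fun σ => Φ σ + g σ) (-g)| ≤ c := norm_gibbsAvg_le (f := -g) hint hgc'
  rw [abs_le] at *
  exact ⟨by linarith, by linarith⟩

variable {V : Type*} [NormedAddCommGroup V] [NormedSpace ℝ V]

lemma abs_apply_le_of_norm_le {a : S → V →L[ℝ] ℝ} {C : ℝ} (haC : ∀ σ, ‖a σ‖ ≤ C) (z : V) (σ : S) :
    |a σ z| ≤ C * ‖z‖ :=
  ((a σ).le_opNorm z).trans (by gcongr; exact haC σ)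

lemma hasFDerivAt_integral_exp_add_mul {a : S → V →L[ℝ] ℝ} {f : S → ℝ} {C B : ℝ}
    (hΦ : Integrable (fun σ => exp (Φ σ)) P)
    (ha : AEStronglyMeasurable a P) (haC : ∀ σ, ‖a σ‖ ≤ C)
    (hf : AEStronglyMeasurable f P) (hfB : ∀ σ, |f σ| ≤ B) (z : V) :
    HasFDerivAt (fun z => ∫ σ, exp (Φ σ + a σ z) * f σ ∂P)
      (∫ σ, exp (Φ σ + a σ z) • f σ • a σ ∂P) z := by
  have hint (z : V) : Integrable (fun σ => exp (Φ σ + a σ z)) P :=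
    integrable_exp_add_of_abs_le hΦ (ha.apply_continuousLinearMap z).aemeasurable
      (abs_apply_le_of_norm_le haC z)
  refine hasFDerivAt_integral_of_dominated_of_fderiv_le
    (F' := fun z σ => exp (Φ σ + a σ z) • f σ • a σ)
    (bound := fun σ => exp (Φ σ) * (exp (C * (‖z‖ + 1)) * (B * C)))
    (Metric.ball_mem_nhds z one_pos)
    (Filter.Eventually.of_forall fun z => (hint z).aestronglyMeasurable.mul hf)
    ((hint z).mul_bdd (c := B) hf (ae_of_all _ hfB))
    ((hint z).aestronglyMeasurable.smul (hf.smul ha))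
    (ae_of_all _ fun σ y hy => ?_) (hΦ.mul_const _) (ae_of_all _ fun σ y _ => ?_)
  · have hC : 0 ≤ C := (norm_nonneg _).trans (haC σ)
    have hB : 0 ≤ B := (abs_nonneg _).trans (hfB σ)
    rw [norm_smul, norm_smul, norm_of_nonneg (exp_pos _).le, exp_add, mul_assoc]
    have hy' : ‖y‖ ≤ ‖z‖ + 1 := by
      have := norm_le_insert' y z
      rw [mem_ball_iff_norm] at hy
      linarith
    have h1 : a σ y ≤ C * (‖z‖ + 1) :=
      (le_abs_self _).trans ((abs_apply_le_of_norm_le haC y σ).trans (by gcongr))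
    gcongr
    · exact hfB σ
    · exact haC σ
  · have h1 : HasFDerivAt (fun z => Φ σ + a σ z) (a σ) y := (a σ).hasFDerivAt.const_add _
    convert! h1.exp.mul_const (f σ) using 1
    rw [smul_comm]

lemma hasFDerivAt_log_integral_exp_add [NeZero P] {a : S → V →L[ℝ] ℝ} {C : ℝ}
    (hΦ : Integrable (fun σ => exp (Φ σ)) P)
    (ha : AEStronglyMeasurable a P) (haC : ∀ σ, ‖a σ‖ ≤ C) (z : V) :
    HasFDerivAt (fun z => log (∫ σ, exp (Φ σ + a σ z) ∂P))
      (gibbsAvg P (fun σ => Φ σ + a σ z) a) z := by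
  have hint : Integrable (fun σ => exp (Φ σ + a σ z)) P :=
    integrable_exp_add_of_abs_le hΦ (ha.apply_continuousLinearMap z).aemeasurable
      (abs_apply_le_of_norm_le haC z)
  have h := hasFDerivAt_integral_exp_add_mul hΦ ha haC (f := fun _ => 1) (B := 1)
    aestronglyMeasurable_const (by simp) z
  simp only [mul_one, one_smul] at h
  exact h.log (integral_exp_pos hint).ne'

/-- The derivative of a Gibbs average along its own tilt is the Gibbs variance. -/
lemma hasDerivAt_gibbsAvg [NeZero P] {f : S → ℝ} {B : ℝ}
    (hΦ : Integrable (fun σ => exp (Φ σ)) P)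
    (hf : AEStronglyMeasurable f P) (hfB : ∀ σ, |f σ| ≤ B) (c u : ℝ) :
    HasDerivAt (fun u => gibbsAvg P (fun σ => Φ σ + u * (c * f σ)) f)
      (c * (gibbsAvg P (fun σ => Φ σ + u * (c * f σ)) (fun σ => f σ ^ 2) -
        gibbsAvg P (fun σ => Φ σ + u * (c * f σ)) f ^ 2)) u := by
  let a : S → ℝ →L[ℝ] ℝ := fun σ => (c * f σ) • ContinuousLinearMap.id ℝ ℝ
  have hau (σ : S) (u : ℝ) : a σ u = u * (c * f σ) := by simp [a, mul_comm]
  have ha : AEStronglyMeasurable a P := (hf.const_mul c).smul_const _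
  have haC (σ : S) : ‖a σ‖ ≤ |c| * B := by
    simp only [a, norm_smul, norm_mul, norm_eq_abs, ContinuousLinearMap.norm_id, mul_one]
    gcongr
    exact hfB σ
  have hint (u : ℝ) : Integrable (fun σ => exp (Φ σ + a σ u)) P :=
    integrable_exp_add_of_abs_le hΦ (ha.apply_continuousLinearMap u).aemeasurable
      (abs_apply_le_of_norm_le haC u)
  have key {g : S → ℝ} {D : ℝ} (hg : AEStronglyMeasurable g P) (hgD : ∀ σ, |g σ| ≤ D) :
      HasDerivAt (fun u => ∫ σ, exp (Φ σ + a σ u) * g σ ∂P)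
        (c * ∫ σ, exp (Φ σ + a σ u) * (f σ * g σ) ∂P) u := by
    have h := (hasFDerivAt_integral_exp_add_mul hΦ ha haC hg hgD u).hasDerivAt
    convert! h using 1
    rw [ContinuousLinearMap.integral_apply, ← integral_const_mul]
    · congr with σ
      simp [a]
      ring
    · refine (hint u).smul_bdd (D * (|c| * B)) (hg.smul ha) (ae_of_all _ fun σ => ?_)
      rw [norm_smul]
      have := (abs_nonneg _).trans (hgD σ)
      gcongr
      · exact hgD σ
      · exact haC σ
  have h1 := key hf hfB
  have h0 := key (g := fun _ => 1) (D := 1) aestronglyMeasurable_const (by simp)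
  simp only [mul_one] at h0
  have hZ := (integral_exp_pos (hint u)).ne'
  have h := h1.div h0 hZ
  simp only [gibbsAvg, smul_eq_mul, hau] at h hZ ⊢
  convert! h using 1
  · ext u
    simp [div_eq_inv_mul]
  · field_simp

lemma integrable_tilted_of_norm_le {E : Type*} [NormedAddCommGroup E] {C : ℝ} {f : S → E}
    (hf : AEStronglyMeasurable f P) (hfC : ∀ σ, ‖f σ‖ ≤ C) : Integrable f (P.tilted Φ) :=
  have : IsFiniteMeasure (P.tilted Φ) := inferInstance
  .of_bound (hf.mono_ac (tilted_absolutelyContinuous _ _)) C (ae_of_all _ hfC)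

lemma gibbsAvg_apply {a : S → V →L[ℝ] ℝ} {C : ℝ} (ha : AEStronglyMeasurable a P)
    (haC : ∀ σ, ‖a σ‖ ≤ C) (v : V) : gibbsAvg P Φ a v = gibbsAvg P Φ (fun σ => a σ v) := by
  simp only [gibbsAvg_eq_integral_tilted]
  exact ContinuousLinearMap.integral_apply (integrable_tilted_of_norm_le ha haC) v

lemma gibbsAvg_comp {E E' : Type*} [NormedAddCommGroup E] [NormedSpace ℝ E] [CompleteSpace E]
    [NormedAddCommGroup E'] [NormedSpace ℝ E'] [CompleteSpace E'] {f : S → E} {C : ℝ}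
    (T : E →L[ℝ] E') (hf : AEStronglyMeasurable f P) (hfC : ∀ σ, ‖f σ‖ ≤ C) :
    gibbsAvg P Φ (fun σ => T (f σ)) = T (gibbsAvg P Φ f) := by
  simp only [gibbsAvg_eq_integral_tilted]
  exact T.integral_comp_comm (integrable_tilted_of_norm_le hf hfC)

lemma sq_integral_le_integral_sq {X : Type*} [MeasurableSpace X] {μ : Measure X}
    [IsProbabilityMeasure μ] {f : X → ℝ} (hf : Integrable f μ)
    (hf2 : Integrable (fun x => f x ^ 2) μ) : (∫ x, f x ∂μ) ^ 2 ≤ ∫ x, f x ^ 2 ∂μ :=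
  (even_two.convexOn_pow (𝕜 := ℝ)).map_integral_le (by fun_prop) isClosed_univ
    (ae_of_all _ fun _ => Set.mem_univ _) hf hf2

lemma sq_gibbsAvg_le [NeZero P] (hΦ : Integrable (fun σ => exp (Φ σ)) P) {f : S → ℝ} {B : ℝ}
    (hf : AEStronglyMeasurable f P) (hfB : ∀ σ, |f σ| ≤ B) :
    gibbsAvg P Φ f ^ 2 ≤ gibbsAvg P Φ (fun σ => f σ ^ 2) := by
  have := isProbabilityMeasure_tilted hΦ
  simp only [gibbsAvg_eq_integral_tilted]
  refine sq_integral_le_integral_sq (integrable_tilted_of_norm_le hf hfB)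
    (integrable_tilted_of_norm_le (C := B ^ 2) (hf.pow 2) fun σ => ?_)
  rw [norm_pow]
  exact pow_le_pow_left₀ (norm_nonneg _) (hfB σ) 2

/-- The Gibbs variance of a bounded vector observable, in coordinates. -/
lemma sum_gibbsAvg_sq_sub_sq [NeZero P] {ι : Type*} [Fintype ι] {m : S → EuclideanSpace ℝ ι}
    {C : ℝ} (hΦ : Integrable (fun σ => exp (Φ σ)) P)
    (hm : AEStronglyMeasurable m P) (hmC : ∀ σ, ‖m σ‖ ≤ C) :
    ∑ i, (gibbsAvg P Φ (fun σ => m σ i ^ 2) - gibbsAvg P Φ (fun σ => m σ i) ^ 2) =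
      gibbsAvg P Φ (fun σ => ‖m σ - gibbsAvg P Φ m‖ ^ 2) := by
  have := isProbabilityMeasure_tilted hΦ
  have hmi (i : ι) : AEStronglyMeasurable (fun σ => m σ i) P :=
    (EuclideanSpace.proj (𝕜 := ℝ) i).continuous.comp_aestronglyMeasurable hm
  have hmiC (i : ι) (σ : S) : |m σ i| ≤ C := (PiLp.norm_apply_le (m σ) i).trans (hmC σ)
  have hcoord (i : ι) : gibbsAvg P Φ m i = gibbsAvg P Φ (fun σ => m σ i) :=
    (gibbsAvg_comp (EuclideanSpace.proj (𝕜 := ℝ) i) hm hmC).symm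
  have hi1 (i : ι) := integrable_tilted_of_norm_le (Φ := Φ) (hmi i) (hmiC i)
  have hi2 (i : ι) : Integrable (fun σ => m σ i ^ 2) (P.tilted Φ) :=
    integrable_tilted_of_norm_le (C := C ^ 2) ((hmi i).pow 2) fun σ => by
      rw [norm_pow]
      exact pow_le_pow_left₀ (norm_nonneg _) (hmiC i σ) 2
  simp only [EuclideanSpace.real_norm_sq_eq, PiLp.sub_apply, hcoord]
  simp only [gibbsAvg_eq_integral_tilted, sub_sq]
  rw [integral_finsetSum]
  · refine Finset.sum_congr rfl fun i _ => ?_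
    rw [integral_add, integral_sub (hi2 i), integral_mul_const, integral_const_mul]
    · simp
      ring
    · exact ((hi1 i).const_mul 2).mul_const _
    · exact (hi2 i).sub (((hi1 i).const_mul 2).mul_const _)
    · exact integrable_const _
  · exact fun i _ => ((hi2 i).sub (((hi1 i).const_mul 2).mul_const _)).add (integrable_const _)

lemma convexOn_log_integral_exp_add [NeZero P] {a : S → V →L[ℝ] ℝ} {C : ℝ}
    (hΦ : Integrable (fun σ => exp (Φ σ)) P)
    (ha : AEStronglyMeasurable a P) (haC : ∀ σ, ‖a σ‖ ≤ C) :
    ConvexOn ℝ Set.univ fun z => log (∫ σ, exp (Φ σ + a σ z) ∂P) := by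
  have tangent (w z : V) : gibbsAvg P (fun σ => Φ σ + a σ w) a (z - w) ≤
      log (∫ σ, exp (Φ σ + a σ z) ∂P) - log (∫ σ, exp (Φ σ + a σ w) ∂P) := by
    rw [gibbsAvg_apply ha haC]
    have h := gibbsAvg_le_log_integral_exp_add_sub
      (integrable_exp_add_of_abs_le hΦ (ha.apply_continuousLinearMap w).aemeasurable
        (abs_apply_le_of_norm_le haC w))
      (ha.apply_continuousLinearMap (z - w)).aemeasurable (abs_apply_le_of_norm_le haC (z - w))
    simpa only [map_sub, add_assoc, add_sub_cancel] using h
  refine ⟨convex_univ, fun z _ z' _ α β hα hβ hαβ => ?_⟩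
  set w := α • z + β • z' with hw
  set D := gibbsAvg P (fun σ => Φ σ + a σ w) a
  have h0 : α * D (z - w) + β * D (z' - w) = 0 := by
    have : α • (z - w) + β • (z' - w) = 0 := by
      rw [smul_sub, smul_sub, sub_add_sub_comm, ← add_smul, hαβ, one_smul, ← hw, sub_self]
    simpa using congrArg D this
  have h1 := mul_le_mul_of_nonneg_left (tangent w z) hα
  have h2 := mul_le_mul_of_nonneg_left (tangent w z') hβ
  have h3 := congrArg (· * log (∫ σ, exp (Φ σ + a σ w) ∂P)) hαβ
  simp only [smul_eq_mul, add_mul, one_mul, mul_sub] at h1 h2 h3 ⊢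
  linarith

section Random

variable {Ω : Type*} [MeasurableSpace Ω] {Pr : Measure Ω} {H : Ω × S → ℝ}

lemma stronglyMeasurable_gibbsAvg [SFinite P] {E : Type*} [NormedAddCommGroup E] [NormedSpace ℝ E]
    {f : Ω × S → E} (hH : Measurable H) (hf : StronglyMeasurable f) :
    StronglyMeasurable fun ω => gibbsAvg P (fun σ => H (ω, σ)) (fun σ => f (ω, σ)) := by
  have hexp : StronglyMeasurable fun p => exp (H p) := hH.exp.stronglyMeasurable
  exact hexp.integral_prod_right'.inv₀.smul (hexp.smul hf).integral_prod_right'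

lemma stronglyMeasurable_log_integral_exp [SFinite P] (hH : Measurable H) :
    StronglyMeasurable fun ω => log (∫ σ, exp (H (ω, σ)) ∂P) :=
  (hH.exp.stronglyMeasurable.integral_prod_right').measurable.log.stronglyMeasurable

lemma integrable_gibbsAvg [SFinite P] [NeZero P] [IsFiniteMeasure Pr]
    {E : Type*} [NormedAddCommGroup E] [NormedSpace ℝ E] {C : ℝ}
    {f : Ω × S → E} (hH : Measurable H) (hHint : ∀ ω, Integrable (fun σ => exp (H (ω, σ))) P)
    (hf : StronglyMeasurable f) (hfC : ∀ p, ‖f p‖ ≤ C) :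
    Integrable (fun ω => gibbsAvg P (fun σ => H (ω, σ)) (fun σ => f (ω, σ))) Pr :=
  .of_bound (stronglyMeasurable_gibbsAvg hH hf).aestronglyMeasurable C
    (ae_of_all _ fun ω => norm_gibbsAvg_le (hHint ω) fun _ => hfC _)

lemma integrable_log_integral_exp_add [SFinite P] [NeZero P] [IsFiniteMeasure Pr] {g : S → ℝ}
    {c : ℝ} (hH : Measurable H) (hHint : ∀ ω, Integrable (fun σ => exp (H (ω, σ))) P)
    (hHlog : Integrable (fun ω => log (∫ σ, exp (H (ω, σ)) ∂P)) Pr)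
    (hg : Measurable g) (hgc : ∀ σ, |g σ| ≤ c) :
    Integrable (fun ω => log (∫ σ, exp (H (ω, σ) + g σ) ∂P)) Pr :=
  integrable_of_norm_sub_le (g := fun _ => c)
    (stronglyMeasurable_log_integral_exp (H := fun p => H p + g p.2)
      (by fun_prop)).aestronglyMeasurable
    hHlog (integrable_const c) (ae_of_all _ fun ω => by
      rw [norm_sub_rev]
      exact abs_log_integral_exp_add_sub_le (hHint ω) hg.aemeasurable hgc)

lemma hasFDerivAt_integral_log_integral_exp_add [SFinite P] [NeZero P] [IsFiniteMeasure Pr]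
    {a : S → V →L[ℝ] ℝ} {C : ℝ}
    (hH : Measurable H) (hHint : ∀ ω, Integrable (fun σ => exp (H (ω, σ))) P)
    (hHlog : Integrable (fun ω => log (∫ σ, exp (H (ω, σ)) ∂P)) Pr)
    (ha : StronglyMeasurable a) (haC : ∀ σ, ‖a σ‖ ≤ C) (z : V) :
    HasFDerivAt (fun z => ∫ ω, log (∫ σ, exp (H (ω, σ) + a σ z) ∂P) ∂Pr)
      (∫ ω, gibbsAvg P (fun σ => H (ω, σ) + a σ z) a ∂Pr) z := by
  have haz (z : V) : Measurable fun σ => a σ z :=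
    ((ContinuousLinearMap.apply ℝ ℝ z).continuous.comp_stronglyMeasurable ha).measurable
  have hint (z : V) (ω : Ω) : Integrable (fun σ => exp (H (ω, σ) + a σ z)) P :=
    integrable_exp_add_of_abs_le (hHint ω) (haz z).aemeasurable (abs_apply_le_of_norm_le haC z)
  have hlog (z : V) := integrable_log_integral_exp_add hH hHint hHlog (haz z)
    (abs_apply_le_of_norm_le haC z)
  refine hasFDerivAt_integral_of_dominated_of_fderiv_le
    (F' := fun z ω => gibbsAvg P (fun σ => H (ω, σ) + a σ z) a) (bound := fun _ => C)
    Filter.univ_mem (Filter.Eventually.of_forall fun z => (hlog z).aestronglyMeasurable) (hlog z)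
    (stronglyMeasurable_gibbsAvg (H := fun p => H p + a p.2 z) (f := fun p => a p.2)
      (hH.add ((haz z).comp measurable_snd)) (ha.comp_measurable measurable_snd)).aestronglyMeasurable
    (ae_of_all _ fun ω y _ => norm_gibbsAvg_le (hint y ω) haC) (integrable_const C)
    (ae_of_all _ fun ω y _ => hasFDerivAt_log_integral_exp_add (hHint ω)
      ha.aestronglyMeasurable haC y)

lemma hasDerivAt_integral_gibbsAvg [SFinite P] [NeZero P] [IsFiniteMeasure Pr] {f : S → ℝ} {B : ℝ}
    (hH : Measurable H) (hHint : ∀ ω, Integrable (fun σ => exp (H (ω, σ))) P)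
    (hf : Measurable f) (hfB : ∀ σ, |f σ| ≤ B) (c u : ℝ) :
    HasDerivAt (fun u => ∫ ω, gibbsAvg P (fun σ => H (ω, σ) + u * (c * f σ)) f ∂Pr)
      (∫ ω, c * (gibbsAvg P (fun σ => H (ω, σ) + u * (c * f σ)) (fun σ => f σ ^ 2) -
        gibbsAvg P (fun σ => H (ω, σ) + u * (c * f σ)) f ^ 2) ∂Pr) u := by
  have hint (u : ℝ) (ω : Ω) : Integrable (fun σ => exp (H (ω, σ) + u * (c * f σ))) P :=
    integrable_exp_add_of_abs_le (c := |u| * (|c| * B)) (hHint ω) (by fun_prop) fun σ => by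
      rw [abs_mul, abs_mul]
      gcongr
      exact hfB σ
  have hHu (u : ℝ) : Measurable fun p : Ω × S => H p + u * (c * f p.2) := by fun_prop
  have hf1 : StronglyMeasurable fun p : Ω × S => f p.2 := by
    exact (hf.comp measurable_snd).stronglyMeasurable
  have hfB2 (σ : S) : ‖f σ ^ 2‖ ≤ B ^ 2 := by
    rw [norm_pow]
    exact pow_le_pow_left₀ (norm_nonneg _) (hfB σ) 2
  refine (hasDerivAt_integral_of_dominated_loc_of_deriv_le (bound := fun _ => |c| * (B ^ 2 + B ^ 2))
    (F' := fun u ω => c * (gibbsAvg P (fun σ => H (ω, σ) + u * (c * f σ)) (fun σ => f σ ^ 2) -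
        gibbsAvg P (fun σ => H (ω, σ) + u * (c * f σ)) f ^ 2))
    Filter.univ_mem
    (Filter.Eventually.of_forall fun u =>
      (stronglyMeasurable_gibbsAvg (hHu u) hf1).aestronglyMeasurable)
    (integrable_gibbsAvg (hHu u) (hint u) hf1 fun p => hfB p.2)
    (((stronglyMeasurable_gibbsAvg (hHu u) (hf1.pow 2)).sub
      ((stronglyMeasurable_gibbsAvg (hHu u) hf1).pow 2)).const_mul c).aestronglyMeasurable
    (ae_of_all _ fun ω y _ => ?_) (integrable_const _)
    (ae_of_all _ fun ω y _ => hasDerivAt_gibbsAvg (hHint ω) hf.aestronglyMeasurable hfB c y)).2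
  rw [norm_mul, norm_eq_abs c]
  gcongr
  refine (norm_sub_le _ _).trans (add_le_add (norm_gibbsAvg_le (hint y ω) hfB2) ?_)
  rw [norm_pow]
  exact pow_le_pow_left₀ (norm_nonneg _) (norm_gibbsAvg_le (hint y ω) hfB) 2

end Random

end Gibbs

/-- For the averaged free energy `F(t,x) = 𝔼 F̃(·,t,x)`, where
`F̃(ω,t,x) = (1/N) log ∫ exp(H(ω,σ) + tN G(m(σ)) + N x·m(σ)) dP(σ)`: `F` is finite
everywhere (each `F̃(·,t,x)` is integrable), jointly convex, Lipschitz with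
`|F(t,x) − F(t',x')| ≤ K|t−t'| + M|x−x'|`, differentiable everywhere with
`∂_t F = 𝔼⟨G∘m⟩`, `∇_x F = 𝔼⟨m⟩`, `Δ_x F = N 𝔼⟨|m − ⟨m⟩|²⟩`, and the approximate
Hamilton–Jacobi estimate
`|∂_t F − G(∇_x F)| ≤ L 𝔼⟨|m − ⟨m⟩|⟩ + L 𝔼|⟨m⟩ − 𝔼⟨m⟩|
  ≤ L (N⁻¹ Δ_x F)^{1/2} + L 𝔼|∇_x F̃ − ∇_x F|` holds. -/
theorem stmt5 {Ω S : Type*} [MeasurableSpace Ω] [MeasurableSpace S]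
    (Pr : Measure Ω) [IsProbabilityMeasure Pr]
    (P : Measure S) [IsFiniteMeasure P] (hP : P ≠ 0)
    (N : ℕ) (hN : 1 ≤ N) (d : ℕ) (M K L : ℝ) (hM : 0 ≤ M) (hK : 0 ≤ K) (hL : 0 ≤ L)
    (H : Ω × S → ℝ) (hH : Measurable H)
    (hHint : ∀ ω, Integrable (fun σ => Real.exp (H (ω, σ))) P)
    (hHpos : ∀ ω, 0 < ∫ σ, Real.exp (H (ω, σ)) ∂P)
    (m : S → EuclideanSpace ℝ (Fin d)) (hm : Measurable m) (hmbd : ∀ σ, ‖m σ‖ ≤ M)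
    (G : EuclideanSpace ℝ (Fin d) → ℝ) (hGmeas : Measurable G)
    (hGbd : ∀ w : EuclideanSpace ℝ (Fin d), ‖w‖ ≤ M → |G w| ≤ K)
    (hGlip : ∀ w w' : EuclideanSpace ℝ (Fin d), ‖w‖ ≤ M → ‖w'‖ ≤ M →
      |G w - G w'| ≤ L * ‖w - w'‖)
    (W : Ω → ℝ → EuclideanSpace ℝ (Fin d) → S → ℝ)
    (hW : ∀ ω t x σ, W ω t x σ = H (ω, σ) + t * N * G (m σ) + N * ⟪x, m σ⟫_ℝ)
    (Ft : Ω → ℝ × EuclideanSpace ℝ (Fin d) → ℝ)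
    (hFt : ∀ ω t x, Ft ω (t, x) = (1 / (N : ℝ)) * Real.log (∫ σ, Real.exp (W ω t x σ) ∂P))
    (hFint : Integrable (fun ω => Ft ω (0, 0)) Pr)
    (F : ℝ × EuclideanSpace ℝ (Fin d) → ℝ)
    (hF : ∀ t x, F (t, x) = ∫ ω, Ft ω (t, x) ∂Pr) :
    (∀ (t : ℝ) (x : EuclideanSpace ℝ (Fin d)), Integrable (fun ω => Ft ω (t, x)) Pr) ∧
    ConvexOn ℝ Set.univ F ∧
    (∀ (t : ℝ) (x : EuclideanSpace ℝ (Fin d)) (t' : ℝ) (x' : EuclideanSpace ℝ (Fin d)),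
      |F (t, x) - F (t', x')| ≤ K * |t - t'| + M * ‖x - x'‖) ∧
    (∀ (t : ℝ) (x : EuclideanSpace ℝ (Fin d)),
      DifferentiableAt ℝ F (t, x) ∧
      HasDerivAt (fun s => F (s, x)) (∫ ω, gibbsAvg P (W ω t x) (fun σ => G (m σ)) ∂Pr) t ∧
      HasGradientAt (fun y => F (t, y)) (∫ ω, gibbsAvg P (W ω t x) m ∂Pr) x) ∧
    (∀ (t : ℝ) (x : EuclideanSpace ℝ (Fin d)),
      (∑ i : Fin d,
          deriv (deriv (fun u : ℝ => F (t, x + u • EuclideanSpace.single i (1 : ℝ)))) 0)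
        = N * ∫ ω, gibbsAvg P (W ω t x) (fun σ => ‖m σ - gibbsAvg P (W ω t x) m‖ ^ 2) ∂Pr) ∧
    (∀ (t : ℝ) (x : EuclideanSpace ℝ (Fin d)),
      |deriv (fun s => F (s, x)) t - G (gradient (fun y => F (t, y)) x)| ≤
          L * (∫ ω, gibbsAvg P (W ω t x) (fun σ => ‖m σ - gibbsAvg P (W ω t x) m‖) ∂Pr)
          + L * (∫ ω, ‖gibbsAvg P (W ω t x) m - ∫ ω', gibbsAvg P (W ω' t x) m ∂Pr‖ ∂Pr) ∧
      L * (∫ ω, gibbsAvg P (W ω t x) (fun σ => ‖m σ - gibbsAvg P (W ω t x) m‖) ∂Pr)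
          + L * (∫ ω, ‖gibbsAvg P (W ω t x) m - ∫ ω', gibbsAvg P (W ω' t x) m ∂Pr‖ ∂Pr) ≤
        L * Real.sqrt ((N : ℝ)⁻¹ * (∑ i : Fin d,
            deriv (deriv (fun u : ℝ => F (t, x + u • EuclideanSpace.single i (1 : ℝ)))) 0))
          + L * ∫ ω, ‖gradient (fun y => Ft ω (t, y)) x - gradient (fun y => F (t, y)) x‖ ∂Pr) := by
  have : NeZero P := ⟨hP⟩
  have hN0 : (0 : ℝ) < N := by exact_mod_cast hN
  have hGm (σ : S) : |G (m σ)| ≤ K := hGbd _ (hmbd σ)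
  have hGmm : Measurable fun σ => G (m σ) := hGmeas.comp hm
  let a : S → (ℝ × EuclideanSpace ℝ (Fin d)) →L[ℝ] ℝ := fun σ =>
    ((N : ℝ) * G (m σ)) • ContinuousLinearMap.fst ℝ ℝ (EuclideanSpace ℝ (Fin d)) +
      (N : ℝ) • (innerSL ℝ (m σ)).comp (ContinuousLinearMap.snd ℝ ℝ (EuclideanSpace ℝ (Fin d)))
  have ha_apply (σ : S) (t : ℝ) (x : EuclideanSpace ℝ (Fin d)) :
      a σ (t, x) = t * N * G (m σ) + N * ⟪x, m σ⟫_ℝ := by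
    simp [a, real_inner_comm]
    ring
  have ha_le (σ : S) (t : ℝ) (x : EuclideanSpace ℝ (Fin d)) :
      |a σ (t, x)| ≤ N * (K * |t| + M * ‖x‖) := by
    have h1 : |t * N * G (m σ)| ≤ N * (K * |t|) := by
      rw [abs_mul, abs_mul, abs_of_pos hN0]
      nlinarith [mul_le_mul_of_nonneg_left (hGm σ) (mul_nonneg (abs_nonneg t) hN0.le)]
    have h2 : |N * ⟪x, m σ⟫_ℝ| ≤ N * (M * ‖x‖) := by
      rw [abs_mul, abs_of_pos hN0, mul_comm M]
      gcongr
      exact (abs_real_inner_le_norm _ _).trans (by gcongr; exact hmbd σ)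
    rw [ha_apply, mul_add]
    exact (abs_add_le _ _).trans (add_le_add h1 h2)
  have haC (σ : S) : ‖a σ‖ ≤ N * (K + M) := by
    refine ContinuousLinearMap.opNorm_le_bound _ (by positivity) fun z => (ha_le σ z.1 z.2).trans ?_
    rw [mul_assoc, add_mul]
    gcongr
    · exact norm_fst_le z
    · exact norm_snd_le z
  have ha : StronglyMeasurable a := by
    have h1 : StronglyMeasurable fun σ =>
        (innerSL ℝ (m σ)).comp (ContinuousLinearMap.snd ℝ ℝ (EuclideanSpace ℝ (Fin d))) :=
      ((ContinuousLinearMap.precomp ℝ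
        (ContinuousLinearMap.snd ℝ ℝ (EuclideanSpace ℝ (Fin d)))).continuous.comp
        (innerSL ℝ).continuous).comp_stronglyMeasurable hm.stronglyMeasurable
    exact ((hGmm.const_mul _).stronglyMeasurable.smul_const _).add (h1.const_smul (N : ℝ))
  have hWa (ω : Ω) (t : ℝ) (x : EuclideanSpace ℝ (Fin d)) :
      W ω t x = fun σ => H (ω, σ) + a σ (t, x) := by
    ext σ
    rw [hW, ha_apply, add_assoc]
  have haz (z : ℝ × EuclideanSpace ℝ (Fin d)) : Measurable fun σ => a σ z :=
    ((ContinuousLinearMap.apply ℝ ℝ z).continuous.comp_stronglyMeasurable ha).measurable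
  have hWint (ω : Ω) (t : ℝ) (x : EuclideanSpace ℝ (Fin d)) :
      Integrable (fun σ => Real.exp (W ω t x σ)) P := by
    rw [hWa]
    exact integrable_exp_add_of_abs_le (hHint ω) (haz _).aemeasurable (ha_le · t x)
  have hWmeas (t : ℝ) (x : EuclideanSpace ℝ (Fin d)) :
      Measurable fun p : Ω × S => W p.1 t x p.2 := by
    simp only [hWa]
    exact hH.add ((haz _).comp measurable_snd)
  have hFt' (ω : Ω) :
      Ft ω = fun z => (N : ℝ)⁻¹ * Real.log (∫ σ, Real.exp (H (ω, σ) + a σ z) ∂P) := by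
    ext ⟨t, x⟩
    rw [hFt, hWa, one_div]
  have hHlog : Integrable (fun ω => Real.log (∫ σ, Real.exp (H (ω, σ)) ∂P)) Pr := by
    convert! hFint.const_mul (N : ℝ) using 2 with ω
    rw [hFt' ω]
    have h0 : ((0 : ℝ), (0 : EuclideanSpace ℝ (Fin d))) = 0 := rfl
    simp [h0, hN0.ne']
  have hFtint (z : ℝ × EuclideanSpace ℝ (Fin d)) : Integrable (fun ω => Ft ω z) Pr := by
    simp only [hFt']
    exact (integrable_log_integral_exp_add hH hHint hHlog (haz z)
      (abs_apply_le_of_norm_le haC z)).const_mul _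
  have hF' : F = fun z => ∫ ω, Ft ω z ∂Pr := by
    ext ⟨t, x⟩
    exact hF t x
  have hFtLip (ω : Ω) (t : ℝ) (x : EuclideanSpace ℝ (Fin d)) (t' : ℝ)
      (x' : EuclideanSpace ℝ (Fin d)) :
      |Ft ω (t, x) - Ft ω (t', x')| ≤ K * |t - t'| + M * ‖x - x'‖ := by
    have h := abs_log_integral_exp_add_sub_le (hWint ω t' x')
      (haz (t - t', x - x')).aemeasurable (ha_le · (t - t') (x - x'))
    have h1 (σ : S) : H (ω, σ) + a σ (t', x') + a σ (t - t', x - x') =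
        H (ω, σ) + a σ (t, x) := by
      rw [add_assoc, ← map_add, Prod.mk_add_mk, add_sub_cancel, add_sub_cancel]
    simp only [hWa, h1] at h
    rw [hFt', ← mul_sub, abs_mul, abs_of_pos (inv_pos.2 hN0), inv_mul_le_iff₀ hN0]
    exact h
  have hFtderiv (ω : Ω) (t : ℝ) (x : EuclideanSpace ℝ (Fin d)) :
      HasFDerivAt (Ft ω) ((N : ℝ)⁻¹ • gibbsAvg P (W ω t x) a) (t, x) := by
    rw [hFt', hWa]
    exact (hasFDerivAt_log_integral_exp_add (hHint ω) ha.aestronglyMeasurable haC (t, x)).const_mul _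
  have hFderiv (t : ℝ) (x : EuclideanSpace ℝ (Fin d)) :
      HasFDerivAt F ((N : ℝ)⁻¹ • ∫ ω, gibbsAvg P (W ω t x) a ∂Pr) (t, x) := by
    rw [hF']
    simp only [hFt', hWa, integral_const_mul]
    exact (hasFDerivAt_integral_log_integral_exp_add hH hHint hHlog ha haC (t, x)).const_mul _
  have hsnd {E : Type _} [TopologicalSpace E] {f : S → E} (hf : StronglyMeasurable f) :
      StronglyMeasurable fun p : Ω × S => f p.2 := hf.comp_measurable measurable_snd
  have hgint {E : Type} [NormedAddCommGroup E] [NormedSpace ℝ E] {C : ℝ} {f : S → E}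
      (hf : StronglyMeasurable f) (hfC : ∀ σ, ‖f σ‖ ≤ C) (t : ℝ) (x : EuclideanSpace ℝ (Fin d)) :
      Integrable (fun ω => gibbsAvg P (W ω t x) f) Pr :=
    integrable_gibbsAvg (hWmeas t x) (hWint · t x) (hsnd hf) fun p => hfC p.2
  have hDt (ω : Ω) (t : ℝ) (x : EuclideanSpace ℝ (Fin d)) :
      gibbsAvg P (W ω t x) a (1, 0) = N * gibbsAvg P (W ω t x) (fun σ => G (m σ)) := by
    rw [gibbsAvg_apply ha.aestronglyMeasurable haC, ← smul_eq_mul,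
      ← ContinuousLinearMap.lsmul_apply (𝕜 := ℝ) (R := ℝ),
      ← gibbsAvg_comp _ hGmm.aestronglyMeasurable hGm]
    simp [ha_apply]
  have hDx (ω : Ω) (t : ℝ) (x y : EuclideanSpace ℝ (Fin d)) :
      gibbsAvg P (W ω t x) a (0, y) = N * ⟪gibbsAvg P (W ω t x) m, y⟫_ℝ := by
    rw [gibbsAvg_apply ha.aestronglyMeasurable haC, real_inner_comm, ← innerSL_apply_apply ℝ,
      ← smul_eq_mul, ← smul_apply, ← gibbsAvg_comp _ hm.aestronglyMeasurable hmbd]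
    simp [ha_apply]
  have hDint (t : ℝ) (x : EuclideanSpace ℝ (Fin d)) (v : ℝ × EuclideanSpace ℝ (Fin d)) :
      (∫ ω, gibbsAvg P (W ω t x) a ∂Pr) v = ∫ ω, gibbsAvg P (W ω t x) a v ∂Pr :=
    ContinuousLinearMap.integral_apply (hgint ha haC t x) v
  have hFdt (t : ℝ) (x : EuclideanSpace ℝ (Fin d)) : HasDerivAt (fun s => F (s, x))
      (∫ ω, gibbsAvg P (W ω t x) (fun σ => G (m σ)) ∂Pr) t := by
    have h := (hFderiv t x).comp_hasDerivAt t ((hasDerivAt_id t).prodMk (hasDerivAt_const t x))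
    convert! h using 1
    simp [hDint, hDt, integral_const_mul, hN0.ne']
  have hFtdx (ω : Ω) (t : ℝ) (x : EuclideanSpace ℝ (Fin d)) :
      HasGradientAt (fun y => Ft ω (t, y)) (gibbsAvg P (W ω t x) m) x := by
    rw [hasGradientAt_iff_hasFDerivAt]
    have h := (hFtderiv ω t x).comp x (hasFDerivAt_prodMk_right t x)
    convert! h using 1
    ext y
    simp [hDx, hN0.ne']
  have hFdx (t : ℝ) (x : EuclideanSpace ℝ (Fin d)) :
      HasGradientAt (fun y => F (t, y)) (∫ ω, gibbsAvg P (W ω t x) m ∂Pr) x := by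
    rw [hasGradientAt_iff_hasFDerivAt]
    have h := (hFderiv t x).comp x (hasFDerivAt_prodMk_right t x)
    convert! h using 1
    ext y
    have h1 : ⟪∫ ω, gibbsAvg P (W ω t x) m ∂Pr, y⟫_ℝ = ∫ ω, ⟪gibbsAvg P (W ω t x) m, y⟫_ℝ ∂Pr := by
      simp only [real_inner_comm y]
      exact (integral_inner (hgint hm.stronglyMeasurable hmbd t x) y).symm
    simp [hDint, hDx, hN0.ne', integral_const_mul, h1]
  have hmi (i : Fin d) : Measurable fun σ => m σ i := by fun_prop
  have hmiM (i : Fin d) (σ : S) : |m σ i| ≤ M := (PiLp.norm_apply_le (m σ) i).trans (hmbd σ)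
  have hFdxi (t : ℝ) (x : EuclideanSpace ℝ (Fin d)) (i : Fin d) (u : ℝ) :
      HasDerivAt (fun u : ℝ => F (t, x + u • EuclideanSpace.single i (1 : ℝ)))
        (∫ ω, gibbsAvg P (fun σ => W ω t x σ + u * (N * m σ i)) (fun σ => m σ i) ∂Pr) u := by
    have h := (hFdx t (x + u • EuclideanSpace.single i (1 : ℝ))).hasFDerivAt.comp_hasDerivAt u
      (((hasDerivAt_id u).smul_const (EuclideanSpace.single i (1 : ℝ))).const_add x)
    convert! h using 1
    rw [one_smul, InnerProductSpace.toDual_apply_apply, real_inner_comm,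
      ← integral_inner (hgint hm.stronglyMeasurable hmbd _ _)]
    refine integral_congr_ae (ae_of_all _ fun ω => ?_)
    have hWu : (fun σ => W ω t x σ + u * (N * m σ i)) =
        W ω t (x + u • EuclideanSpace.single i (1 : ℝ)) := by
      ext σ
      simp only [hW, inner_add_left, real_inner_smul_left, EuclideanSpace.inner_single_left]
      simp
      ring
    simp only [hWu]
    rw [← innerSL_apply_apply ℝ, ← gibbsAvg_comp _ hm.aestronglyMeasurable hmbd]
    simp [EuclideanSpace.inner_single_left]
  have hm' (t : ℝ) (x : EuclideanSpace ℝ (Fin d)) :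
      StronglyMeasurable fun p : Ω × S => ‖m p.2 - gibbsAvg P (W p.1 t x) m‖ :=
    ((hsnd hm.stronglyMeasurable).sub ((stronglyMeasurable_gibbsAvg (hWmeas t x)
      (hsnd hm.stronglyMeasurable)).comp_measurable measurable_fst)).norm
  have hgM (ω : Ω) (t : ℝ) (x : EuclideanSpace ℝ (Fin d)) : ‖gibbsAvg P (W ω t x) m‖ ≤ M :=
    norm_gibbsAvg_le (hWint ω t x) hmbd
  have hdev (ω : Ω) (t : ℝ) (x : EuclideanSpace ℝ (Fin d)) (σ : S) :
      ‖m σ - gibbsAvg P (W ω t x) m‖ ≤ M + M :=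
    (norm_sub_le _ _).trans (add_le_add (hmbd σ) (hgM ω t x))
  have hlap (t : ℝ) (x : EuclideanSpace ℝ (Fin d)) : (∑ i : Fin d,
      deriv (deriv (fun u : ℝ => F (t, x + u • EuclideanSpace.single i (1 : ℝ)))) 0)
        = N * ∫ ω, gibbsAvg P (W ω t x) (fun σ => ‖m σ - gibbsAvg P (W ω t x) m‖ ^ 2) ∂Pr := by
    have h1 (i : Fin d) :
        deriv (deriv fun u : ℝ => F (t, x + u • EuclideanSpace.single i (1 : ℝ))) 0 =
          ∫ ω, N * (gibbsAvg P (W ω t x) (fun σ => m σ i ^ 2) -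
          gibbsAvg P (W ω t x) (fun σ => m σ i) ^ 2) ∂Pr := by
      rw [show deriv (fun u : ℝ => F (t, x + u • EuclideanSpace.single i (1 : ℝ))) = _ from
        funext fun u => (hFdxi t x i u).deriv]
      simpa using
        (hasDerivAt_integral_gibbsAvg (hWmeas t x) (hWint · t x) (hmi i) (hmiM i) N 0).deriv
    have hmi2 (i : Fin d) (σ : S) : ‖m σ i ^ 2‖ ≤ M ^ 2 := by
      rw [norm_pow]
      exact pow_le_pow_left₀ (norm_nonneg _) (hmiM i σ) 2
    simp only [h1]
    rw [← integral_finsetSum, ← integral_const_mul]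
    · simp only [← Finset.mul_sum,
        sum_gibbsAvg_sq_sub_sq (hWint _ t x) hm.aestronglyMeasurable hmbd]
    · intro i _
      refine ((hgint ((hmi i).pow_const 2).stronglyMeasurable (hmi2 i) t x).sub ?_).const_mul _
      refine .of_bound ((hgint (hmi i).stronglyMeasurable (hmiM i) t x).aestronglyMeasurable.pow 2)
        (M ^ 2) (ae_of_all _ fun ω => ?_)
      rw [norm_pow]
      exact pow_le_pow_left₀ (norm_nonneg _) (norm_gibbsAvg_le (hWint ω t x) (hmiM i)) 2
  refine ⟨fun t x => hFtint (t, x), ⟨convex_univ, fun z _ z' _ α β hα hβ hαβ => ?_⟩,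
    fun t x t' x' => ?_, fun t x => ⟨(hFderiv t x).differentiableAt, hFdt t x, hFdx t x⟩,
    hlap, fun t x => ?_⟩
  · have hconv (ω : Ω) : ConvexOn ℝ Set.univ (Ft ω) := by
      rw [hFt']
      exact (convexOn_log_integral_exp_add (hHint ω) ha.aestronglyMeasurable haC).smul
        (inv_nonneg.2 hN0.le)
    simp only [hF', smul_eq_mul, ← integral_const_mul]
    rw [← integral_add ((hFtint z).const_mul α) ((hFtint z').const_mul β)]
    exact integral_mono (hFtint _) (((hFtint z).const_mul α).add ((hFtint z').const_mul β))
      fun ω => (hconv ω).2 trivial trivial hα hβ hαβ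
  · rw [hF, hF, ← integral_sub (hFtint _) (hFtint _)]
    simpa using norm_integral_le_of_norm_le_const (μ := Pr)
      (f := fun ω => Ft ω (t, x) - Ft ω (t', x')) (ae_of_all _ fun ω => hFtLip ω t x t' x')
  · rw [(hFdt t x).deriv, (hFdx t x).gradient, hlap t x, inv_mul_cancel_left₀ hN0.ne']
    simp only [(hFtdx _ t x).gradient]
    have hdevint : Integrable (fun ω => gibbsAvg P (W ω t x)
        (fun σ => ‖m σ - gibbsAvg P (W ω t x) m‖)) Pr :=
      integrable_gibbsAvg (f := fun p : Ω × S => ‖m p.2 - gibbsAvg P (W p.1 t x) m‖) (C := M + M)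
        (hWmeas t x) (hWint · t x) (hm' t x) fun p => by simpa using hdev p.1 t x p.2
    set q := ∫ ω, gibbsAvg P (W ω t x) m ∂Pr with hq
    have hqM : ‖q‖ ≤ M := by
      simpa using norm_integral_le_of_norm_le_const (μ := Pr) (ae_of_all _ fun ω => hgM ω t x)
    have hqint : Integrable (fun ω => ‖gibbsAvg P (W ω t x) m - q‖) Pr :=
      ((hgint hm.stronglyMeasurable hmbd t x).sub (integrable_const q)).norm
    have hdevω (ω : Ω) : AEStronglyMeasurable (fun σ => ‖m σ - gibbsAvg P (W ω t x) m‖) P :=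
      (hm.sub_const _).norm.aestronglyMeasurable
    constructor
    · rw [← integral_const_mul, ← integral_const_mul,
        ← integral_add (hdevint.const_mul L) (hqint.const_mul L)]
      have h1 : (∫ ω, gibbsAvg P (W ω t x) (fun σ => G (m σ)) ∂Pr) - G q =
          ∫ ω, (gibbsAvg P (W ω t x) (fun σ => G (m σ)) - G q) ∂Pr := by
        rw [integral_sub (hgint hGmm.stronglyMeasurable hGm t x) (integrable_const _)]
        simp
      rw [h1, ← Real.norm_eq_abs]
      refine norm_integral_le_of_norm_le ((hdevint.const_mul L).add (hqint.const_mul L))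
        (ae_of_all _ fun ω => ?_)
      have := isProbabilityMeasure_tilted (hWint ω t x)
      have hi1 := integrable_tilted_of_norm_le (P := P) (Φ := W ω t x) hGmm.aestronglyMeasurable hGm
      have hi2 := integrable_tilted_of_norm_le (Φ := W ω t x) (C := M + M) (hdevω ω)
        (by simpa using hdev ω t x)
      have h2 : gibbsAvg P (W ω t x) (fun σ => G (m σ)) - G q =
          ∫ σ, (G (m σ) - G q) ∂(P.tilted (W ω t x)) := by
        rw [integral_sub hi1 (integrable_const _), gibbsAvg_eq_integral_tilted]
        simp
      have h3 : L * gibbsAvg P (W ω t x) (fun σ => ‖m σ - gibbsAvg P (W ω t x) m‖) +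
          L * ‖gibbsAvg P (W ω t x) m - q‖ = ∫ σ, (L * ‖m σ - gibbsAvg P (W ω t x) m‖ +
            L * ‖gibbsAvg P (W ω t x) m - q‖) ∂(P.tilted (W ω t x)) := by
        rw [integral_add (hi2.const_mul L) (integrable_const _), integral_const_mul,
          gibbsAvg_eq_integral_tilted P _ fun σ => ‖m σ - gibbsAvg P (W ω t x) m‖]
        simp
      rw [h2, h3]
      refine norm_integral_le_of_norm_le ((hi2.const_mul L).add (integrable_const _))
        (ae_of_all _ fun σ => (hGlip _ _ (hmbd σ) hqM).trans ?_)
      rw [← mul_add]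
      gcongr
      exact norm_sub_le_norm_sub_add_norm_sub _ _ _
    · have hbd2 (ω : Ω) (σ : S) : ‖‖m σ - gibbsAvg P (W ω t x) m‖ ^ 2‖ ≤ (M + M) ^ 2 := by
        rw [norm_pow, norm_norm]
        exact pow_le_pow_left₀ (norm_nonneg _) (hdev ω t x σ) 2
      have hint2 : Integrable (fun ω => gibbsAvg P (W ω t x)
          (fun σ => ‖m σ - gibbsAvg P (W ω t x) m‖ ^ 2)) Pr :=
        integrable_gibbsAvg (f := fun p : Ω × S => ‖m p.2 - gibbsAvg P (W p.1 t x) m‖ ^ 2)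
          (hWmeas t x) (hWint · t x) ((hm' t x).pow 2) fun p => hbd2 p.1 p.2
      have hsq (ω : Ω) : gibbsAvg P (W ω t x) (fun σ => ‖m σ - gibbsAvg P (W ω t x) m‖) ^ 2 ≤
          gibbsAvg P (W ω t x) (fun σ => ‖m σ - gibbsAvg P (W ω t x) m‖ ^ 2) :=
        sq_gibbsAvg_le (B := M + M) (hWint ω t x) (hdevω ω) (by simpa using hdev ω t x)
      gcongr
      refine Real.le_sqrt_of_sq_le ?_
      have hsqint : Integrable (fun ω => gibbsAvg P (W ω t x)
          (fun σ => ‖m σ - gibbsAvg P (W ω t x) m‖) ^ 2) Pr :=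
        hint2.mono' (hdevint.aestronglyMeasurable.pow 2) (ae_of_all _ fun ω => by
          rw [norm_pow, Real.norm_eq_abs, sq_abs]
          exact hsq ω)
      exact (sq_integral_le_integral_sq hdevint hsqint).trans (integral_mono hsqint hint2 hsq)
end

section
/- Let P be a probability measure on a measurable space S and let g : S → ℝ be bounded and measurable. For s ∈ ℝ, let μ_s be the probability measure on S with density e^{s g}/∫_S e^{s g} dP with respect to P, and define Φ(s) = ∬ |g(σ) − g(σ')| dμ_s(σ) dμ_s(σ') and V(s) = ∫ (g − ∫ g dμ_s)² dμ_s. Then: (i) Φ is differentiable on ℝ with Φ'(s) = ∭ |g(σ¹) − g(σ²)| ( g(σ¹) + g(σ²) − 2 g(σ³) ) dμ_s(σ¹) dμ_s(σ²) dμ_s(σ³); (ii) Φ'(s) ≥ −8 V(s) for every s; (iii) consequently, for every r > 0, Φ(0) ≤ (1/r) ∫_0^r Φ(s) ds + 8 ∫_0^r V(s) ds. -/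
open MeasureTheory intervalIntegral

/-- A bounded measurable function is integrable with respect to a finite measure. -/
lemma integrable_of_abs_le {Ω : Type*} [MeasurableSpace Ω] {Q : Measure Ω} [IsFiniteMeasure Q]
    {f : Ω → ℝ} (hf : Measurable f) {C : ℝ} (hC : ∀ ω, |f ω| ≤ C) : Integrable f Q :=
  Integrable.of_bound hf.aestronglyMeasurable C (Filter.Eventually.of_forall hC)

lemma integrable_mul_exp_of_abs_le {Ω : Type*} [MeasurableSpace Ω] {Q : Measure Ω}
    [IsFiniteMeasure Q] {f h : Ω → ℝ} (hf : Measurable f) (hh : Measurable h) {Cf Ch : ℝ}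
    (hCf : ∀ ω, |f ω| ≤ Cf) (hCh : ∀ ω, |h ω| ≤ Ch) (s : ℝ) :
    Integrable (fun ω => f ω * Real.exp (s * h ω)) Q := by
  refine integrable_of_abs_le (by fun_prop) (C := Cf * Real.exp (|s| * Ch)) fun ω => ?_
  rw [abs_mul, Real.abs_exp]
  have hle : s * h ω ≤ |s| * Ch :=
    (le_abs_self _).trans ((abs_mul s (h ω)).le.trans
      (mul_le_mul_of_nonneg_left (hCh ω) (abs_nonneg s)))
  exact mul_le_mul (hCf ω) (Real.exp_le_exp.2 hle) (Real.exp_pos _).le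
    ((abs_nonneg _).trans (hCf ω))

lemma integrable_exp_mul_of_abs_le {Ω : Type*} [MeasurableSpace Ω] {Q : Measure Ω}
    [IsFiniteMeasure Q] {h : Ω → ℝ} (hh : Measurable h) {Ch : ℝ} (hCh : ∀ ω, |h ω| ≤ Ch) (s : ℝ) :
    Integrable (fun ω => Real.exp (s * h ω)) Q := by
  simpa using integrable_mul_exp_of_abs_le (Q := Q) (f := fun _ => 1) measurable_const hh
    (fun _ => le_rfl) hCh s

lemma hasDerivAt_integral_mul_exp {Ω : Type*} [MeasurableSpace Ω] {Q : Measure Ω}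
    [IsFiniteMeasure Q] {f h : Ω → ℝ} (hf : Measurable f) (hh : Measurable h) {Cf Ch : ℝ}
    (hCf : ∀ ω, |f ω| ≤ Cf) (hCh : ∀ ω, |h ω| ≤ Ch) (s : ℝ) :
    HasDerivAt (fun t => ∫ ω, f ω * Real.exp (t * h ω) ∂Q)
      (∫ ω, f ω * h ω * Real.exp (s * h ω) ∂Q) s := by
  refine (hasDerivAt_integral_of_dominated_loc_of_deriv_le (Metric.ball_mem_nhds s one_pos)
    (F' := fun t ω => f ω * h ω * Real.exp (t * h ω))
    (bound := fun _ => Cf * Ch * Real.exp ((|s| + 1) * Ch))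
    (Filter.Eventually.of_forall fun t => ?_) (integrable_mul_exp_of_abs_le hf hh hCf hCh s)
    (by fun_prop) (Filter.Eventually.of_forall fun ω t ht => ?_) (integrable_const _)
    (Filter.Eventually.of_forall fun ω t _ => ?_)).2
  · exact Measurable.aestronglyMeasurable (by fun_prop)
  · have hCf0 : 0 ≤ Cf := (abs_nonneg _).trans (hCf ω)
    have hCh0 : 0 ≤ Ch := (abs_nonneg _).trans (hCh ω)
    have ht' : |t| ≤ |s| + 1 := by
      have := abs_add_le s (t - s)
      rw [Metric.mem_ball, Real.dist_eq] at ht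
      rw [add_sub_cancel] at this
      linarith
    have hle : t * h ω ≤ (|s| + 1) * Ch :=
      (le_abs_self _).trans ((abs_mul t (h ω)).le.trans
        (mul_le_mul ht' (hCh ω) (abs_nonneg _) (by positivity)))
    rw [Real.norm_eq_abs, abs_mul, abs_mul, Real.abs_exp]
    exact mul_le_mul (mul_le_mul (hCf ω) (hCh ω) (abs_nonneg _) hCf0) (Real.exp_le_exp.2 hle)
      (Real.exp_pos _).le (mul_nonneg hCf0 hCh0)
  · exact (((hasDerivAt_mul_const (h ω)).exp).const_mul (f ω)).congr_deriv (by ring)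

lemma integral_tilted_mul {Ω : Type*} [MeasurableSpace Ω] (Q : Measure Ω) (f h : Ω → ℝ) (s : ℝ) :
    ∫ ω, f ω ∂(Q.tilted fun ω => s * h ω) =
      (∫ ω, f ω * Real.exp (s * h ω) ∂Q) / ∫ ω, Real.exp (s * h ω) ∂Q := by
  rw [integral_tilted, ← MeasureTheory.integral_div]
  congr with ω
  rw [smul_eq_mul]
  ring

/-- The derivative of a Gibbs expectation in the tilting parameter is a Gibbs covariance. -/
lemma hasDerivAt_integral_tilted {Ω : Type*} [MeasurableSpace Ω] {Q : Measure Ω}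
    [IsProbabilityMeasure Q] {f h : Ω → ℝ} (hf : Measurable f) (hh : Measurable h) {Cf Ch : ℝ}
    (hCf : ∀ ω, |f ω| ≤ Cf) (hCh : ∀ ω, |h ω| ≤ Ch) (s : ℝ) :
    HasDerivAt (fun t => ∫ ω, f ω ∂(Q.tilted fun ω => t * h ω))
      ((∫ ω, f ω * h ω ∂(Q.tilted fun ω => s * h ω)) -
        (∫ ω, f ω ∂(Q.tilted fun ω => s * h ω)) * ∫ ω, h ω ∂(Q.tilted fun ω => s * h ω)) s := by
  have hpos : 0 < ∫ ω, Real.exp (s * h ω) ∂Q :=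
    integral_exp_pos (integrable_exp_mul_of_abs_le hh hCh s)
  have hD : HasDerivAt (fun t => ∫ ω, Real.exp (t * h ω) ∂Q)
      (∫ ω, h ω * Real.exp (s * h ω) ∂Q) s := by
    simpa using hasDerivAt_integral_mul_exp (Q := Q) (f := fun _ => 1) measurable_const hh
      (fun _ => le_rfl) hCh s
  simp only [integral_tilted_mul]
  refine ((hasDerivAt_integral_mul_exp hf hh hCf hCh s).fun_div hD hpos.ne').congr_deriv ?_
  rw [sub_div, sq, mul_div_mul_right _ _ hpos.ne', div_mul_div_comm]

lemma tilted_prod_tilted {Ω : Type*} [MeasurableSpace Ω] (Q : Measure Ω) [SFinite Q] {h : Ω → ℝ}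
    (hh : Measurable h) (s : ℝ) :
    (Q.tilted fun ω => s * h ω).prod (Q.tilted fun ω => s * h ω) =
      (Q.prod Q).tilted fun q => s * (h q.1 + h q.2) := by
  simp only [Measure.tilted]
  rw [prod_withDensity (by fun_prop) (by fun_prop)]
  congr with q
  simp only [mul_add, Real.exp_add]
  rw [integral_prod_mul (fun ω => Real.exp (s * h ω)) (fun ω => Real.exp (s * h ω)),
    ← ENNReal.ofReal_mul (by positivity), div_mul_div_comm]

lemma integral_prod_prod_abs_sub_mul {Ω : Type*} [MeasurableSpace Ω] {Q : Measure Ω}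
    [IsProbabilityMeasure Q] {g : Ω → ℝ} (hg : Measurable g) {K : ℝ} (hK : ∀ ω, |g ω| ≤ K) :
    ∫ q : Ω × Ω × Ω, |g q.1 - g q.2.1| * (g q.1 + g q.2.1 - 2 * g q.2.2) ∂(Q.prod (Q.prod Q)) =
      ∫ q : Ω × Ω, |g q.1 - g q.2| * (g q.1 + g q.2 - 2 * ∫ ω, g ω ∂Q) ∂(Q.prod Q) := by
  have hb : ∀ (x y : Ω) (c : ℝ), |c| ≤ K → |(|g x - g y| * (g x + g y - 2 * c))| ≤ 8 * K ^ 2 := by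
    intro x y c hc
    have hx := abs_le.1 (hK x)
    have hy := abs_le.1 (hK y)
    have hc := abs_le.1 hc
    have h1 : |g x - g y| ≤ 2 * K := abs_le.2 ⟨by linarith, by linarith⟩
    have h2 : |g x + g y - 2 * c| ≤ 4 * K := abs_le.2 ⟨by linarith, by linarith⟩
    rw [abs_mul, abs_abs]
    nlinarith [mul_le_mul h1 h2 (abs_nonneg _) (by linarith)]
  have hm : |∫ ω, g ω ∂Q| ≤ K := by
    simpa using norm_integral_le_of_norm_le_const (μ := Q) (f := g) (Filter.Eventually.of_forall hK)
  have hint : Integrable g Q := integrable_of_abs_le hg hK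
  rw [integral_prod _ (integrable_of_abs_le (by fun_prop) fun q : Ω × Ω × Ω =>
      hb q.1 q.2.1 (g q.2.2) (hK q.2.2)),
    integral_prod _ (integrable_of_abs_le (by fun_prop) fun q : Ω × Ω => hb q.1 q.2 _ hm)]
  congr with x
  rw [integral_prod _ (integrable_of_abs_le (by fun_prop) fun q : Ω × Ω =>
    hb x q.1 (g q.2) (hK q.2))]
  congr with y
  dsimp only
  rw [MeasureTheory.integral_const_mul, integral_sub (integrable_const _) (hint.const_mul 2),
    MeasureTheory.integral_const_mul, MeasureTheory.integral_const]
  simp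

lemma neg_two_mul_variance_le_integral_prod {Ω : Type*} [MeasurableSpace Ω] {Q : Measure Ω}
    [IsProbabilityMeasure Q] {g : Ω → ℝ} (hg : Measurable g) {K : ℝ} (hK : ∀ ω, |g ω| ≤ K) (m : ℝ) :
    -2 * ∫ ω, (g ω - m) ^ 2 ∂Q ≤
      ∫ q : Ω × Ω, |g q.1 - g q.2| * (g q.1 + g q.2 - 2 * m) ∂(Q.prod Q) := by
  have hsub : ∀ ω, |g ω - m| ≤ K + |m| := fun ω =>
    (abs_sub _ _).trans (add_le_add_left (hK ω) _)
  have hsq : Integrable (fun ω => (g ω - m) ^ 2) Q :=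
    integrable_of_abs_le (by fun_prop) (C := (K + |m|) ^ 2) fun ω => by
      rw [abs_pow]
      exact pow_le_pow_left₀ (abs_nonneg _) (hsub ω) 2
  have hfst := hsq.comp_fst Q
  have hsnd := hsq.comp_snd Q
  have hkey : ∀ a b : ℝ, |(|a - b| * (a + b))| ≤ a ^ 2 + b ^ 2 := by
    intro a b
    rw [abs_mul, abs_abs]
    nlinarith [sq_nonneg (|a - b| - |a + b|), sq_abs (a - b), sq_abs (a + b)]
  have hpt : ∀ q : Ω × Ω, |(|g q.1 - g q.2| * (g q.1 + g q.2 - 2 * m))| ≤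
      (g q.1 - m) ^ 2 + (g q.2 - m) ^ 2 := fun q => by
    convert hkey (g q.1 - m) (g q.2 - m) using 3 <;> ring_nf
  have hint : Integrable (fun q : Ω × Ω => |g q.1 - g q.2| * (g q.1 + g q.2 - 2 * m))
      (Q.prod Q) :=
    (hfst.add hsnd).mono' (Measurable.aestronglyMeasurable (by fun_prop))
      (Filter.Eventually.of_forall hpt)
  calc -2 * ∫ ω, (g ω - m) ^ 2 ∂Q
      = ∫ q : Ω × Ω, -((g q.1 - m) ^ 2 + (g q.2 - m) ^ 2) ∂(Q.prod Q) := by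
        rw [MeasureTheory.integral_neg, integral_add hfst hsnd, integral_fun_fst (fun ω => (g ω - m) ^ 2),
          integral_fun_snd (fun ω => (g ω - m) ^ 2)]
        simp
        ring
    _ ≤ _ := integral_mono (hfst.add hsnd).neg hint fun q => (abs_le.1 (hpt q)).1

lemma le_average_add_integral_of_hasDerivAt {Φ Φ' V : ℝ → ℝ} (hΦ : ∀ s, HasDerivAt Φ (Φ' s) s)
    (hV : Continuous V) (hV0 : ∀ s, 0 ≤ V s) {c : ℝ} (hc : 0 ≤ c) (hle : ∀ s, -c * V s ≤ Φ' s)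
    {r : ℝ} (hr : 0 < r) :
    Φ 0 ≤ (1 / r) * (∫ s in (0:ℝ)..r, Φ s) + c * ∫ s in (0:ℝ)..r, V s := by
  have hΦc : Continuous Φ := continuous_iff_continuousAt.2 fun s => (hΦ s).continuousAt
  have hmono : Monotone fun s => Φ s + c * ∫ t in (0:ℝ)..s, V t :=
    monotone_of_hasDerivAt_nonneg
      (fun s => (hΦ s).add ((hV.integral_hasStrictDerivAt 0 s).hasDerivAt.const_mul c))
      fun s => by
        have := hle s
        simp only [Pi.zero_apply]
        linarith
  have hpt : ∀ s ∈ Set.Icc 0 r, Φ 0 - c * (∫ t in (0:ℝ)..r, V t) ≤ Φ s := by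
    intro s hs
    have h0 : Φ 0 + c * (∫ t in (0:ℝ)..0, V t) ≤ Φ s + c * ∫ t in (0:ℝ)..s, V t := hmono hs.1
    have hsr : ∫ t in (0:ℝ)..s, V t ≤ ∫ t in (0:ℝ)..r, V t :=
      integral_mono_interval le_rfl hs.1 hs.2 (Filter.Eventually.of_forall hV0)
        (hV.intervalIntegrable _ _)
    rw [integral_same] at h0
    nlinarith [mul_le_mul_of_nonneg_left hsr hc]
  have hint := integral_mono_on (μ := volume) hr.le (continuous_const.intervalIntegrable _ _)
    (hΦc.intervalIntegrable _ _) hpt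
  rw [intervalIntegral.integral_const, sub_zero, smul_eq_mul] at hint
  rw [← sub_le_iff_le_add, one_div, inv_mul_eq_div, le_div_iff₀ hr, mul_comm]
  exact hint

/-- For a bounded measurable `g` and the tilted probability measures
`dμ_s = (e^{s g}/∫ e^{s g} dP) dP`, the function
`Φ(s) = ∬ |g(σ) − g(σ')| dμ_s dμ_s` is differentiable with
`Φ'(s) = ∭ |g(σ¹) − g(σ²)| (g(σ¹) + g(σ²) − 2g(σ³)) dμ_s³`, one has `Φ'(s) ≥ −8V(s)` for
the Gibbs variance `V(s)`, and consequently
`Φ(0) ≤ (1/r)∫₀^r Φ(s) ds + 8∫₀^r V(s) ds` for every `r > 0`. -/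
theorem stmt14 {S : Type*} [MeasurableSpace S] (P : Measure S) [IsProbabilityMeasure P]
    (g : S → ℝ) (hg : Measurable g) (Kg : ℝ) (hKg : ∀ σ, |g σ| ≤ Kg)
    (μ : ℝ → Measure S)
    (hμ : ∀ s, μ s = P.withDensity fun σ =>
      ENNReal.ofReal (Real.exp (s * g σ) / ∫ τ, Real.exp (s * g τ) ∂P))
    (Φ V Φ' : ℝ → ℝ)
    (hΦ : ∀ s, Φ s = ∫ q : S × S, |g q.1 - g q.2| ∂((μ s).prod (μ s)))
    (hV : ∀ s, V s = ∫ σ, (g σ - ∫ τ, g τ ∂(μ s)) ^ 2 ∂(μ s))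
    (hΦ' : ∀ s, Φ' s = ∫ q : S × S × S,
      |g q.1 - g q.2.1| * (g q.1 + g q.2.1 - 2 * g q.2.2) ∂((μ s).prod ((μ s).prod (μ s)))) :
    (∀ s : ℝ, HasDerivAt Φ (Φ' s) s) ∧
    (∀ s : ℝ, -8 * V s ≤ Φ' s) ∧
    (∀ r : ℝ, 0 < r → Φ 0 ≤ (1 / r) * (∫ s in (0:ℝ)..r, Φ s) + 8 * ∫ s in (0:ℝ)..r, V s) := by
  have hμt : ∀ s, μ s = P.tilted fun σ => s * g σ := hμ
  have hprob : ∀ s, IsProbabilityMeasure (μ s) := fun s => by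
    rw [hμt]
    exact isProbabilityMeasure_tilted (integrable_exp_mul_of_abs_le hg hKg s)
  have hgint : ∀ s, Integrable g (μ s) := fun s => integrable_of_abs_le hg hKg
  have hgsq : ∀ σ, |g σ ^ 2| ≤ Kg ^ 2 := fun σ => by
    rw [abs_pow]
    exact pow_le_pow_left₀ (abs_nonneg _) (hKg σ) 2
  have hdiff : ∀ q : S × S, |(|g q.1 - g q.2|)| ≤ Kg + Kg := fun q => by
    rw [abs_abs]
    exact (abs_sub _ _).trans (add_le_add (hKg _) (hKg _))
  have hsum : ∀ q : S × S, |g q.1 + g q.2| ≤ Kg + Kg := fun q =>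
    (abs_add_le _ _).trans (add_le_add (hKg _) (hKg _))
  have hder : ∀ s, HasDerivAt Φ (Φ' s) s := by
    intro s
    have hprod : ∀ t, (μ t).prod (μ t) = (P.prod P).tilted fun q => t * (g q.1 + g q.2) :=
      fun t => by rw [hμt, tilted_prod_tilted P hg]
    have hE := hasDerivAt_integral_tilted (Q := P.prod P) (f := fun q => |g q.1 - g q.2|)
      (h := fun q => g q.1 + g q.2) (by fun_prop) (by fun_prop) hdiff hsum s
    simp only [← hprod] at hE
    rw [funext hΦ]
    convert hE using 1
    have hf : Integrable (fun q : S × S => |g q.1 - g q.2|) ((μ s).prod (μ s)) :=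
      integrable_of_abs_le (by fun_prop) hdiff
    have hfh : Integrable (fun q : S × S => |g q.1 - g q.2| * (g q.1 + g q.2))
        ((μ s).prod (μ s)) :=
      hf.mul_bdd (by fun_prop) (Filter.Eventually.of_forall hsum)
    rw [hΦ', integral_prod_prod_abs_sub_mul hg hKg,
      integral_add ((hgint s).comp_fst _) ((hgint s).comp_snd _), integral_fun_fst g,
      integral_fun_snd g]
    simp only [mul_sub, probReal_univ, one_smul]
    rw [integral_sub hfh (hf.mul_const _), MeasureTheory.integral_mul_const]
    ring
  have hV0 : ∀ s, 0 ≤ V s := fun s => by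
    rw [hV]
    positivity
  have hVc : Continuous V := by
    have hc1 : Continuous fun s => ∫ σ, g σ ∂(μ s) := continuous_iff_continuousAt.2 fun s => by
      simp only [hμt]
      exact (hasDerivAt_integral_tilted hg hg hKg hKg s).continuousAt
    have hc2 : Continuous fun s => ∫ σ, g σ ^ 2 ∂(μ s) := continuous_iff_continuousAt.2 fun s => by
      simp only [hμt]
      exact (hasDerivAt_integral_tilted (hg.pow_const 2) hg hgsq hKg s).continuousAt
    have hVar : V = fun s => (∫ σ, g σ ^ 2 ∂(μ s)) - (∫ σ, g σ ∂(μ s)) ^ 2 := by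
      funext s
      rw [hV, ← ProbabilityTheory.variance_eq_integral hg.aemeasurable]
      exact ProbabilityTheory.variance_eq_sub
        (MemLp.of_bound hg.aestronglyMeasurable Kg (Filter.Eventually.of_forall hKg))
    rw [hVar]
    exact hc2.sub (hc1.pow 2)
  have hle : ∀ s, -8 * V s ≤ Φ' s := fun s => by
    have := neg_two_mul_variance_le_integral_prod (Q := μ s) hg hKg (∫ τ, g τ ∂(μ s))
    rw [← hV, ← integral_prod_prod_abs_sub_mul hg hKg, ← hΦ'] at this
    linarith [hV0 s]
  exact ⟨hder, hle, fun r hr =>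
    le_average_add_integral_of_hasDerivAt hder hVc hV0 (by norm_num) hle hr⟩
end
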